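/- Fix nonnegative reals λ₁, …, λ_p and, for each ρ > 0, let γ⋆(ρ) be the unique positive solution of (ρ² − ½·Σᵢ λᵢ)·γ − p + ½·Σᵢ √(λᵢ²γ² + 4λᵢγ) = 0 and define xᵢ(ρ) := γ⋆(ρ)·[ 1 − ½·( √(λᵢ²γ⋆(ρ)² + 4λᵢγ⋆(ρ)) − λᵢγ⋆(ρ) ) ]. Then for each i = 1, …, p, the eigenvalue xᵢ(ρ) is a decreasing function of ρ on (0, ∞), and xᵢ(ρ) → 0 as ρ → ∞. -/

import Mathlib

/-- The shrunk eigenvalue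
`x(λ, γ) = γ [ 1 − ½ ( √(λ²γ² + 4λγ) − λγ ) ]`. -/
noncomputable def shrunkEig (lam γ : ℝ) : ℝ :=
  γ * (1 - (Real.sqrt (lam ^ 2 * γ ^ 2 + 4 * lam * γ) - lam * γ) / 2)

/-- The shrinkage fraction `½ (√(λ²γ² + 4λγ) − λγ)`, the nonnegative root `s` of
`s² = λγ (1 − s)`. -/
noncomputable def shrinkFraction (lam γ : ℝ) : ℝ :=
  (Real.sqrt (lam ^ 2 * γ ^ 2 + 4 * lam * γ) - lam * γ) / 2

theorem shrunkEig_eq (lam γ : ℝ) : shrunkEig lam γ = γ * (1 - shrinkFraction lam γ) := rfl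

section

variable {lam γ γ' : ℝ}

theorem shrinkFraction_nonneg (hl : 0 ≤ lam) (hγ : 0 ≤ γ) : 0 ≤ shrinkFraction lam γ := by
  have hu : 0 ≤ lam * γ := mul_nonneg hl hγ
  have : lam * γ ≤ Real.sqrt (lam ^ 2 * γ ^ 2 + 4 * lam * γ) :=
    Real.le_sqrt_of_sq_le (by nlinarith)
  unfold shrinkFraction
  linarith

theorem shrinkFraction_le_one (hl : 0 ≤ lam) (hγ : 0 ≤ γ) : shrinkFraction lam γ ≤ 1 := by
  have hu : 0 ≤ lam * γ := mul_nonneg hl hγ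
  have : Real.sqrt (lam ^ 2 * γ ^ 2 + 4 * lam * γ) ≤ lam * γ + 2 :=
    Real.sqrt_le_iff.mpr ⟨by linarith, by nlinarith⟩
  unfold shrinkFraction
  linarith

theorem shrinkFraction_sq (hl : 0 ≤ lam) (hγ : 0 ≤ γ) :
    shrinkFraction lam γ ^ 2 = lam * γ * (1 - shrinkFraction lam γ) := by
  have hu : 0 ≤ lam * γ := mul_nonneg hl hγ
  have := Real.sq_sqrt (show 0 ≤ lam ^ 2 * γ ^ 2 + 4 * lam * γ by nlinarith [sq_nonneg (lam * γ)])
  unfold shrinkFraction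
  linear_combination this / 4

theorem shrinkFraction_mono (hl : 0 ≤ lam) (hγ : 0 ≤ γ) (h : γ ≤ γ') :
    shrinkFraction lam γ ≤ shrinkFraction lam γ' := by
  have hγ' := hγ.trans h
  by_contra! hlt
  have h0 := shrinkFraction_nonneg hl hγ'
  have hsq : shrinkFraction lam γ' ^ 2 < shrinkFraction lam γ ^ 2 :=
    pow_lt_pow_left₀ hlt h0 two_ne_zero
  rw [shrinkFraction_sq hl hγ, shrinkFraction_sq hl hγ'] at hsq
  refine hsq.not_ge (mul_le_mul ?_ (by linarith) ?_ (mul_nonneg hl hγ'))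
  · exact mul_le_mul_of_nonneg_left h hl
  · linarith [shrinkFraction_le_one hl hγ]

theorem shrunkEig_mono (hl : 0 ≤ lam) (hγ : 0 ≤ γ) (h : γ ≤ γ') :
    shrunkEig lam γ ≤ shrunkEig lam γ' := by
  have hγ' := hγ.trans h
  rcases hl.eq_or_lt with rfl | hpos
  · simpa [shrunkEig] using h
  · refine le_of_mul_le_mul_left ?_ hpos
    rw [shrunkEig_eq, shrunkEig_eq, ← mul_assoc, ← mul_assoc, ← shrinkFraction_sq hl hγ,
      ← shrinkFraction_sq hl hγ']
    exact pow_le_pow_left₀ (shrinkFraction_nonneg hl hγ) (shrinkFraction_mono hl hγ h) 2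

theorem shrunkEig_nonneg (hl : 0 ≤ lam) (hγ : 0 ≤ γ) : 0 ≤ shrunkEig lam γ :=
  mul_nonneg hγ (sub_nonneg.mpr (shrinkFraction_le_one hl hγ))

theorem shrunkEig_le (hl : 0 ≤ lam) (hγ : 0 ≤ γ) : shrunkEig lam γ ≤ γ :=
  mul_le_of_le_one_right hγ (sub_le_self 1 (shrinkFraction_nonneg hl hγ))

end

theorem sum_shrinkFraction {p : ℕ} (lam : Fin p → ℝ) (γ : ℝ) :
    ∑ i, shrinkFraction (lam i) γ =
      (∑ i, Real.sqrt ((lam i) ^ 2 * γ ^ 2 + 4 * lam i * γ)) / 2 - (∑ i, lam i) / 2 * γ := by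
  simp only [shrinkFraction]
  rw [← Finset.sum_div, Finset.sum_sub_distrib, ← Finset.sum_mul]
  ring

/-- Let `γ⋆(ρ)` denote, for each `ρ > 0`, the unique positive
solution of `(ρ² − ½ Σ λᵢ) γ − p + ½ Σ √(λᵢ²γ² + 4λᵢγ) = 0` (with `λᵢ ≥ 0`),
and set `xᵢ(ρ) = γ⋆(ρ)[1 − ½(√(λᵢ²γ⋆(ρ)² + 4λᵢγ⋆(ρ)) − λᵢγ⋆(ρ))]`.  Then for
each `i`, `xᵢ` is decreasing on `(0, ∞)` and `xᵢ(ρ) → 0` as `ρ → ∞`. -/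
theorem shrunk_eigenvalues_antitone_tendsto_zero
    {p : ℕ} (hp : 1 ≤ p)
    (lam : Fin p → ℝ) (hlam : ∀ i, 0 ≤ lam i)
    (γstar : ℝ → ℝ)
    (hγ : ∀ ρ : ℝ, 0 < ρ →
      0 < γstar ρ ∧
      (ρ ^ 2 - (∑ i, lam i) / 2) * γstar ρ - p
        + (∑ i, Real.sqrt ((lam i) ^ 2 * (γstar ρ) ^ 2 + 4 * lam i * γstar ρ)) / 2 = 0) :
    ∀ i : Fin p,
      AntitoneOn (fun ρ => shrunkEig (lam i) (γstar ρ)) (Set.Ioi 0) ∧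
      Filter.Tendsto (fun ρ => shrunkEig (lam i) (γstar ρ)) Filter.atTop (nhds 0) := by
  have heq : ∀ ρ, 0 < ρ → ρ ^ 2 * γstar ρ + ∑ i, shrinkFraction (lam i) (γstar ρ) = p := by
    intro ρ hρ
    rw [sum_shrinkFraction]
    linear_combination (hγ ρ hρ).2
  have hanti : AntitoneOn γstar (Set.Ioi 0) := by
    intro a ha b hb hab
    by_contra! hlt
    have ha' : 0 < a := ha
    have hsum : ∑ i, shrinkFraction (lam i) (γstar a) ≤ ∑ i, shrinkFraction (lam i) (γstar b) :=
      Finset.sum_le_sum fun i _ => shrinkFraction_mono (hlam i) (hγ a ha).1.le hlt.le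
    have hmul : a ^ 2 * γstar a < b ^ 2 * γstar b :=
      mul_lt_mul' (pow_le_pow_left₀ ha'.le hab 2) hlt (hγ a ha).1.le (pow_pos hb 2)
    linarith [heq a ha, heq b hb]
  have hbound : ∀ ρ, 0 < ρ → γstar ρ ≤ p / ρ ^ 2 := by
    intro ρ hρ
    rw [le_div_iff₀ (pow_pos hρ 2)]
    have := Finset.sum_nonneg fun i (_ : i ∈ Finset.univ) =>
      shrinkFraction_nonneg (hlam i) (hγ ρ hρ).1.le
    linarith [heq ρ hρ]
  intro i
  refine ⟨fun a ha b hb hab => shrunkEig_mono (hlam i) (hγ b hb).1.le (hanti ha hb hab), ?_⟩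
  have hlim : Filter.Tendsto (fun ρ : ℝ => (p : ℝ) / ρ ^ 2) Filter.atTop (nhds 0) :=
    tendsto_const_nhds.div_atTop (Filter.tendsto_pow_atTop two_ne_zero)
  refine tendsto_of_tendsto_of_tendsto_of_le_of_le' tendsto_const_nhds hlim ?_ ?_
  · filter_upwards [Filter.eventually_gt_atTop 0] with ρ hρ
    exact shrunkEig_nonneg (hlam i) (hγ ρ hρ).1.le
  · filter_upwards [Filter.eventually_gt_atTop 0] with ρ hρ
    exact (shrunkEig_le (hlam i) (hγ ρ hρ).1.le).trans (hbound ρ hρ)
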